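/- arXiv:math/9910131 — 5 statements merged into one kernel-verified Lean document; each statement's English description precedes it below -/
import Mathlib

section
/- Let R be a unital QB-ring. Then R is a B-ring (i.e. for all a, x, b in R with x a + b = 1 there exists y such that a + y b is invertible) if and only if every quasi-invertible element of R is invertible, i.e. R_q^{-1} = R^{-1}. -/
/-- `x` and `y` are centrally orthogonal: `x r y = 0` and `y r x = 0` for all `r`. -/
def CentOrth {R : Type*} [Ring R] (x y : R) : Prop :=
  ∀ r : R, x * r * y = 0 ∧ y * r * x = 0

/-- `u` is quasi-invertible: `(1 - u a) ⊥ (1 - b u)` for some `a, b`. -/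
def QuasiInv {R : Type*} [Ring R] (u : R) : Prop :=
  ∃ a b : R, CentOrth (1 - u * a) (1 - b * u)

/-- `R` is a QB-ring. -/
def IsQB (R : Type*) [Ring R] : Prop :=
  ∀ a x b : R, x * a + b = 1 → ∃ y : R, QuasiInv (a + y * b)

/-- `R` is a B-ring (Bass stable rank one). -/
def IsB (R : Type*) [Ring R] : Prop :=
  ∀ a x b : R, x * a + b = 1 → ∃ y : R, IsUnit (a + y * b)

/-- A quasi-invertible element has an inner inverse `c` with `(1 - u c) R (1 - c u) = 0`. -/
theorem QuasiInv.exists_inner_inverse {R : Type*} [Ring R] {u : R} (hu : QuasiInv u) :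
    ∃ c : R, u * c * u = u ∧ ∀ r : R, (1 - u * c) * r * (1 - c * u) = 0 := by
  obtain ⟨a, b, h⟩ := hu
  refine ⟨a + b - a * u * b, ?_, fun r => ?_⟩
  · have h₁ := (h u).1
    rw [← sub_eq_zero, ← neg_eq_zero, ← h₁]
    noncomm_ring
  · have hp : 1 - u * (a + b - a * u * b) = (1 - u * a) * (1 - u * b) := by noncomm_ring
    have hq : 1 - (a + b - a * u * b) * u = (1 - a * u) * (1 - b * u) := by noncomm_ring
    rw [hp, hq]
    simpa only [mul_assoc] using (h ((1 - u * b) * r * (1 - a * u))).1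

theorem IsUnit.quasiInv {R : Type*} [Ring R] {u : R} (hu : IsUnit u) : QuasiInv u := by
  obtain ⟨a, ha⟩ := hu.exists_right_inv
  exact ⟨a, 0, fun r => by simp [ha]⟩

/-- In a ring of Bass stable rank one, quasi-invertible elements are invertible. -/
theorem IsB.isUnit_of_quasiInv {R : Type*} [Ring R] (hB : IsB R) {u : R} (hu : QuasiInv u) :
    IsUnit u := by
  obtain ⟨c, hc, h⟩ := hu.exists_inner_inverse
  obtain ⟨y, hw⟩ := hB u c (1 - c * u) (add_sub_cancel _ _)
  set w := u + y * (1 - c * u) with hwdef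
  have hwc : w * c * u = u := by
    have hidem : (1 - c * u) * (c * u) = 0 := by
      rw [sub_mul, one_mul, mul_assoc c u, ← mul_assoc u c u, hc, sub_self]
    rw [mul_assoc, hwdef, add_mul, mul_assoc y, hidem, mul_zero, add_zero, ← mul_assoc, hc]
  have huc : u * c = 1 := by
    have hzero : (1 - u * c) * w = 0 := by
      rw [hwdef, mul_add, ← mul_assoc, h, add_zero, sub_mul, one_mul, hc, sub_self]
    exact (sub_eq_zero.mp (hw.mul_left_eq_zero.mp hzero)).symm
  have hwc_one : w * c = 1 := by
    rw [← mul_one (w * c), ← huc, ← mul_assoc, hwc]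
  have hcw : c * w = 1 := hw.mul_left_cancel (by rw [← mul_assoc, hwc_one, one_mul, mul_one])
  have huw : w = u := by
    rw [← one_mul w, ← huc, mul_assoc, hcw, mul_one]
  exact huw ▸ hw

/-- Proposition 3.9: a QB-ring is a B-ring iff every quasi-invertible element is invertible. -/
theorem qb_is_b_iff {R : Type*} [Ring R] (hR : IsQB R) :
    IsB R ↔ (∀ u : R, QuasiInv u ↔ IsUnit u) := by
  refine ⟨fun hB u => ⟨hB.isUnit_of_quasiInv, IsUnit.quasiInv⟩, fun h a x b hab => ?_⟩
  obtain ⟨y, hy⟩ := hR a x b hab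
  exact ⟨y, (h _).mp hy⟩
end

section
/- Let R be a simple, purely infinite unital ring, i.e. R is simple, R is not a division ring, and for every nonzero x in R there exist s, t in R with s x t = 1. Then R is a QB-ring, but for every n ≥ 1 the ring R does not have n in its stable range (so R has infinite Bass stable rank). -/
/-- `R` has `n` in its stable range: every left unimodular row of length `n + 1`
can be shortened. -/
def InStableRange (R : Type*) [Ring R] (n : ℕ) : Prop :=
  ∀ a : Fin (n + 1) → R, (∃ f : Fin (n + 1) → R, ∑ i, f i * a i = 1) →
    ∃ y : Fin n → R, ∃ g : Fin n → R, ∑ i, g i * (a i.succ + y i * a 0) = 1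

theorem QuasiInv.of_mul_eq_one {R : Type*} [Ring R] {u a : R} (h : u * a = 1) : QuasiInv u :=
  ⟨a, 0, fun r => by simp [h]⟩

theorem QuasiInv.of_mul_eq_one_left {R : Type*} [Ring R] {u b : R} (h : b * u = 1) :
    QuasiInv u :=
  ⟨0, b, fun r => by simp [h]⟩

/-- If every nonzero element factors the identity, then `R` is a QB-ring. -/
theorem IsQB.of_forall_exists_mul_mul_eq_one {R : Type*} [Ring R] [Nontrivial R]
    (hpi : ∀ x : R, x ≠ 0 → ∃ s t : R, s * x * t = 1) : IsQB R := by
  intro a x b h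
  by_cases hb : b = 0
  · refine ⟨0, .of_mul_eq_one_left (b := x) ?_⟩
    simpa [hb] using h
  obtain ⟨s, t, hst⟩ := hpi b hb
  have ht : t ≠ 0 := by
    rintro rfl
    simp at hst
  obtain ⟨c, d, hcd⟩ := hpi t ht
  -- `a - a * t * s * b` annihilates `t`, and the complement `(1 + x * a * t * s) * b` fixes `t`.
  refine ⟨c * (1 + x * a * t * s) - a * t * s, .of_mul_eq_one (a := t * d) ?_⟩
  have hxt : x * a * t + b * t = t := by rw [← add_mul, h, one_mul]
  calc (a + (c * (1 + x * a * t * s) - a * t * s) * b) * (t * d)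
      = a * t * d + c * (b * t) * d + c * (x * a * t) * (s * b * t) * d
          - a * t * (s * b * t) * d := by noncomm_ring
    _ = c * (x * a * t + b * t) * d := by rw [hst]; noncomm_ring
    _ = 1 := by rw [hxt, hcd]

/-- A system of orthogonal one-sided inverses whose idempotents do not add up to `1` yields a
unimodular row that cannot be shortened. -/
theorem not_inStableRange_of_orthogonal {R : Type*} [Ring R] {n : ℕ} (s t : Fin n → R)
    (hst : ∀ i j, s i * t j = if i = j then 1 else 0) (hne : ∑ i, t i * s i ≠ 1) :
    ¬ InStableRange R n := by
  intro hsr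
  set e : R := 1 - ∑ i, t i * s i with he
  have het (j) : e * t j = 0 := by
    simp [he, sub_mul, Finset.sum_mul, mul_assoc, hst]
  have hse (j) : s j * e = 0 := by
    simp [he, mul_sub, Finset.mul_sum, ← mul_assoc, hst]
  obtain ⟨y, g, hg⟩ := hsr (Fin.cons e s) ⟨Fin.cons 1 t, by simp [Fin.sum_univ_succ, he]⟩
  simp only [Fin.cons_succ, Fin.cons_zero] at hg
  have hgt (j) : g j = t j := by
    have := congrArg (· * t j) hg
    simpa [Finset.sum_mul, mul_assoc, add_mul, hst, het] using this
  simp only [hgt] at hg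
  have hy (j) : y j * e = 0 := by
    have := congrArg (s j * ·) hg
    simpa [Finset.mul_sum, ← mul_assoc, hst] using this
  exact hne (by simpa [hy] using hg)

/-- A pair of orthogonal one-sided inverses obstructs every finite stable range. -/
theorem not_inStableRange_of_pair {R : Type*} [Ring R] [Nontrivial R] {p q u v : R}
    (hpq : p * q = 1) (huv : u * v = 1) (huq : u * q = 0) (hpv : p * v = 0) (n : ℕ) :
    ¬ InStableRange R n := by
  have hpow (k : ℕ) : p ^ k * q ^ k = 1 := by
    induction k with
    | zero => simp
    | succ k ih => rw [pow_succ, pow_succ', mul_assoc, ← mul_assoc p, hpq, one_mul, ih]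
  have key (i j : ℕ) : u * p ^ i * (q ^ j * v) = if i = j then 1 else 0 := by
    rcases lt_trichotomy i j with h | rfl | h
    · obtain ⟨k, rfl⟩ := Nat.exists_eq_add_of_lt h
      rw [if_neg (by omega), add_assoc, pow_add, pow_succ']
      calc u * p ^ i * (q ^ i * (q * q ^ k) * v)
          = u * (p ^ i * q ^ i) * (q * q ^ k) * v := by simp only [mul_assoc]
        _ = 0 := by rw [hpow, mul_one, ← mul_assoc, huq]; simp
    · rw [if_pos rfl, mul_assoc, ← mul_assoc (p ^ i), hpow, one_mul, huv]
    · obtain ⟨k, rfl⟩ := Nat.exists_eq_add_of_lt h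
      rw [if_neg (by omega), show j + k + 1 = k + 1 + j by omega, pow_add, pow_succ]
      calc u * (p ^ k * p * p ^ j) * (q ^ j * v)
          = u * p ^ k * (p * ((p ^ j * q ^ j) * v)) := by simp only [mul_assoc]
        _ = 0 := by rw [hpow, one_mul, hpv, mul_zero]
  refine not_inStableRange_of_orthogonal (fun i : Fin n => u * p ^ (i : ℕ))
    (fun i => q ^ (i : ℕ) * v) (fun i j => by simp [key, Fin.ext_iff]) fun hsum => ?_
  have hzero : u * p ^ n = 0 := by
    rw [← mul_one (u * p ^ n), ← hsum, Finset.mul_sum]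
    refine Finset.sum_eq_zero fun i _ => ?_
    rw [← mul_assoc, key, if_neg i.isLt.ne', zero_mul]
  have := key n n
  simp [hzero] at this

/-- Proposition 3.10: a simple, purely infinite ring is a QB-ring with infinite
Bass stable rank. -/
theorem simple_purely_infinite_isQB {R : Type*} [Ring R] [IsSimpleRing R]
    (hnotdiv : ¬ ∀ x : R, x ≠ 0 → IsUnit x)
    (hpi : ∀ x : R, x ≠ 0 → ∃ s t : R, s * x * t = 1) :
    IsQB R ∧ ∀ n : ℕ, 1 ≤ n → ¬ InStableRange R n := by
  refine ⟨.of_forall_exists_mul_mul_eq_one hpi, fun n _ => ?_⟩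
  have hinf : ∃ p q : R, p * q = 1 ∧ q * p ≠ 1 := by
    by_contra! hfin
    refine hnotdiv fun x hx => ?_
    obtain ⟨s, t, h⟩ := hpi x hx
    have h₁ : x * t * s = 1 := hfin s (x * t) (by rw [← mul_assoc, h])
    have h₂ : t * s * x = 1 := hfin x (t * s) (by rw [← mul_assoc, h₁])
    exact ⟨⟨x, t * s, by rw [← mul_assoc, h₁], h₂⟩, rfl⟩
  obtain ⟨p, q, hpq, hqp⟩ := hinf
  obtain ⟨c, d, hcd⟩ := hpi (1 - q * p) (sub_ne_zero.2 hqp.symm)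
  have hidem : (1 - q * p) * (1 - q * p) = 1 - q * p := by
    have : q * p * (q * p) = q * p := by rw [mul_assoc, ← mul_assoc p, hpq, one_mul]
    simp [mul_sub, sub_mul, this]
  refine not_inStableRange_of_pair (u := c * (1 - q * p)) (v := (1 - q * p) * d) hpq ?_ ?_ ?_ n
  · rw [mul_assoc, ← mul_assoc (1 - q * p), hidem, ← mul_assoc, hcd]
  · rw [mul_assoc, sub_mul, mul_assoc q, hpq]
    simp
  · rw [← mul_assoc, mul_sub, ← mul_assoc, hpq]
    simp
end

section
/- If R is a unital QB-ring, then for every natural number n ≥ 1 the matrix ring M_n(R) of n × n matrices over R is also a QB-ring. -/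
theorem CentOrth.mul_units {R : Type*} [Ring R] {x y : R} (h : CentOrth x y) (g k : Rˣ) :
    CentOrth (g * x * (g⁻¹ : Rˣ)) (k * y * (k⁻¹ : Rˣ)) := by
  intro r
  constructor
  · calc g * x * (g⁻¹ : Rˣ) * r * (k * y * (k⁻¹ : Rˣ))
        = g * (x * ((g⁻¹ : Rˣ) * r * k) * y) * (k⁻¹ : Rˣ) := by simp only [mul_assoc]
      _ = 0 := by rw [(h _).1]; simp
  · calc k * y * (k⁻¹ : Rˣ) * r * (g * x * (g⁻¹ : Rˣ))
        = k * (y * ((k⁻¹ : Rˣ) * r * g) * x) * (g⁻¹ : Rˣ) := by simp only [mul_assoc]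
      _ = 0 := by rw [(h _).2]; simp

namespace QuasiInv

variable {R : Type*} [Ring R]

theorem mul_units {u : R} (h : QuasiInv u) (g k : Rˣ) : QuasiInv (g * u * k) := by
  obtain ⟨a, b, h⟩ := h
  refine ⟨(k⁻¹ : Rˣ) * a * (g⁻¹ : Rˣ), (k⁻¹ : Rˣ) * b * (g⁻¹ : Rˣ), ?_⟩
  convert h.mul_units g k⁻¹ using 1
  · simp [mul_sub, sub_mul, mul_assoc]
  · simp [mul_sub, sub_mul, mul_assoc]

theorem units_mul_mul_iff {u : R} (g k : Rˣ) : QuasiInv (g * u * k) ↔ QuasiInv u := by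
  refine ⟨fun h => ?_, fun h => h.mul_units g k⟩
  simpa [mul_assoc] using h.mul_units g⁻¹ k⁻¹

theorem map {S : Type*} [Ring S] (e : R ≃+* S) {u : R} (h : QuasiInv u) : QuasiInv (e u) := by
  obtain ⟨a, b, h⟩ := h
  refine ⟨e a, e b, fun r => ?_⟩
  have := h (e.symm r)
  constructor
  · simpa using congrArg e this.1
  · simpa using congrArg e this.2

end QuasiInv

/-- `v` is a reflexive generalized inverse of `u` with centrally orthogonal defects
`p = 1 - u v` and `q = 1 - v u`. -/
structure QuasiInverse {R : Type*} [Ring R] (u v p q : R) : Prop where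
  mul_inv : u * v = 1 - p
  inv_mul : v * u = 1 - q
  p_mul : p * u = 0
  mul_p : v * p = 0
  mul_q : u * q = 0
  q_mul : q * v = 0
  orth : CentOrth p q

theorem QuasiInv.exists_quasiInverse {R : Type*} [Ring R] {u : R} (h : QuasiInv u) :
    ∃ v p q, QuasiInverse u v p q := by
  obtain ⟨a, b, h⟩ := h
  have hreg : u * (a + b - a * u * b) * u = u := by
    have h' := (h u).1
    rw [← sub_eq_zero, ← neg_eq_zero, ← h']
    noncomm_ring
  have hp : 1 - u * (a + b - a * u * b) = (1 - u * a) * (1 - u * b) := by noncomm_ring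
  have hq : 1 - (a + b - a * u * b) * u = (1 - a * u) * (1 - b * u) := by noncomm_ring
  generalize a + b - a * u * b = v at hreg hp hq
  have huv : u * (v * u * v) = u * v := by rw [← mul_assoc, ← mul_assoc, hreg]
  have hvu : v * u * v * u = v * u := by rw [mul_assoc, mul_assoc, ← mul_assoc u, hreg]
  refine ⟨v * u * v, 1 - u * v, 1 - v * u, ?_, ?_, ?_, ?_, ?_, ?_, fun r => ?_⟩
  · rw [huv]; abel
  · rw [hvu]; abel
  · rw [sub_mul, hreg, one_mul, sub_self]
  · rw [mul_sub, ← mul_assoc, hvu, mul_one, sub_self]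
  · rw [mul_sub, ← mul_assoc, hreg, mul_one, sub_self]
  · rw [sub_mul, one_mul, mul_assoc v u (v * u * v), huv, ← mul_assoc, sub_self]
  · rw [hp, hq]
    constructor
    · simpa only [mul_assoc] using (h ((1 - u * b) * r * (1 - a * u))).1
    · calc (1 - a * u) * (1 - b * u) * r * ((1 - u * a) * (1 - u * b))
          = (1 - a * u) * ((1 - b * u) * r * (1 - u * a)) * (1 - u * b) := by
            simp only [mul_assoc]
        _ = 0 := by rw [(h r).2, mul_zero, zero_mul]

namespace QuasiInverse

variable {R : Type*} [Ring R] {u v p q : R}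

theorem p_mul_p (h : QuasiInverse u v p q) : p * p = p := by
  have : u * (v * p) = (1 - p) * p := by rw [← mul_assoc, h.mul_inv]
  rw [h.mul_p, mul_zero, sub_mul, one_mul] at this
  exact (sub_eq_zero.1 this.symm).symm

theorem q_mul_q (h : QuasiInverse u v p q) : q * q = q := by
  have : v * (u * q) = (1 - q) * q := by rw [← mul_assoc, h.inv_mul]
  rw [h.mul_q, mul_zero, sub_mul, one_mul] at this
  exact (sub_eq_zero.1 this.symm).symm

end QuasiInverse

/-- The unit `1 + n` for an element `n` of square zero. -/
def unitOneAdd {R : Type*} [Ring R] (n : R) (h : n * n = 0) : Rˣ where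
  val := 1 + n
  inv := 1 - n
  val_inv := by
    have : (1 + n) * (1 - n) = 1 - n * n := by noncomm_ring
    rw [this, h, sub_zero]
  inv_val := by
    have : (1 - n) * (1 + n) = 1 - n * n := by noncomm_ring
    rw [this, h, sub_zero]

@[simp]
theorem val_unitOneAdd {R : Type*} [Ring R] (n : R) (h : n * n = 0) :
    (unitOneAdd n h : R) = 1 + n := rfl

/-- Given a centrally orthogonal pair of defects `p` from one quasi-invertible element and `q'`
from another one, the QB-condition holds in the skew corner `p R q'`. -/
theorem IsQB.exists_skew {R : Type*} [Ring R] (hR : IsQB R) {u v p q u' v' p' q' c x β : R}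
    (h : QuasiInverse u v p q) (h' : QuasiInverse u' v' p' q')
    (hpc : p * c = c) (hcq : c * q' = c) (hx : x * p = x) (hqβ : q' * β = β)
    (hβ : β * q' = β) (hxc : x * c + β = q') :
    ∃ y s : R, p * y = y ∧ y * q' = y ∧ q' * s = s ∧ s * p = s ∧
      CentOrth (p - (c + y * β) * s) (q' - s * (c + y * β)) := by
  have hvc : v * c = 0 := by rw [← hpc, ← mul_assoc, h.mul_p, zero_mul]
  have hcv : c * v' = 0 := by rw [← hcq, mul_assoc, h'.q_mul, mul_zero]
  have hβv : β * v' = 0 := by rw [← hβ, mul_assoc, h'.q_mul, mul_zero]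
  have hxu : x * u = 0 := by rw [← hx, mul_assoc, h.p_mul, mul_zero]
  obtain ⟨y, hy⟩ := hR (u * u' + c) (x + v' * v) (β + v' * q * u') <| by
    calc _ = x * u * u' + (x * c + β) + v' * (v * u) * u' + v' * (v * c) + v' * q * u' := by
          noncomm_ring
      _ = q' + v' * u' := by rw [hxu, hxc, h.inv_mul, hvc]; noncomm_ring
      _ = 1 := by rw [h'.inv_mul]; abel
  set W := u * u' + c + y * (β + v' * q * u') with hW
  set m := (1 - p) * y * β with hm
  have hmq : m * q' = m := by rw [hm, mul_assoc, hβ]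
  have hmv : m * v' = 0 := by rw [← hmq, mul_assoc, h'.q_mul, mul_zero]
  have hpm : p * m = 0 := by
    have : p * m = (p - p * p) * y * β := by rw [hm]; noncomm_ring
    rw [this, h.p_mul_p]; simp
  have hpvm (r : R) : p' * r * m = 0 := by
    rw [← hmq, ← mul_assoc, mul_assoc p', (h'.orth _).1]
  have hWm : W * (v' * v * m) = m := by
    calc _ = u * (u' * v') * v * m + c * v' * v * m + y * (β * v') * v * m
          + y * v' * q * (u' * v') * v * m := by rw [hW]; noncomm_ring
      _ = u * v * m - u * (p' * v * m) + y * v' * (q * v) * m - y * v' * q * (p' * v * m) := by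
        rw [h'.mul_inv, hcv, hβv]; noncomm_ring
      _ = m - p * m := by rw [hpvm, h.q_mul, h.mul_inv]; noncomm_ring
      _ = m := by rw [hpm, sub_zero]
  have hsq : -(v' * v * m) * -(v' * v * m) = 0 := by
    calc _ = v' * v * (m * v') * v * m := by noncomm_ring
      _ = 0 := by rw [hmv]; simp
  have hW' : QuasiInv (W - m) := by
    have := hy.mul_units 1 (unitOneAdd _ hsq)
    rwa [val_unitOneAdd, Units.val_one, one_mul, mul_add, mul_neg, hWm, mul_one,
      ← sub_eq_add_neg] at this
  have hpW : p * (W - m) = c + p * y * β := by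
    calc _ = p * u * u' + p * c + p * y * β + p * (y * v') * q * u' - p * m := by
          rw [hW]; noncomm_ring
      _ = c + p * y * β := by rw [h.p_mul, hpc, (h.orth _).1, hpm]; simp
  have hWq : (W - m) * q' = c + p * y * β := by
    calc _ = u * (u' * q') + c * q' + y * (β * q') + y * v' * q * (u' * q') - m * q' := by
          rw [hW]; noncomm_ring
      _ = c + y * β - m := by rw [h'.mul_q, hcq, hβ, hmq]; simp
      _ = c + p * y * β := by rw [hm]; noncomm_ring
  obtain ⟨V, P, Q, hV⟩ := hW'.exists_quasiInverse
  generalize W - m = W' at hpW hWq hV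
  have hyβ : p * y * q' * β = p * y * β := by rw [mul_assoc, hqβ]
  refine ⟨p * y * q', q' * V * p, ?_, ?_, ?_, ?_, fun r => ?_⟩
  · rw [← mul_assoc, ← mul_assoc, h.p_mul_p]
  · rw [mul_assoc, h'.q_mul_q]
  · rw [← mul_assoc, ← mul_assoc, h'.q_mul_q]
  · rw [mul_assoc, h.p_mul_p]
  rw [hyβ]
  have e₁ : p - (c + p * y * β) * (q' * V * p) = p * P * p := by
    calc _ = p - W' * (q' * q') * V * p := by rw [← hWq]; noncomm_ring
      _ = p - p * W' * V * p := by rw [h'.q_mul_q, hWq, hpW]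
      _ = p * p - p * (W' * V) * p := by rw [h.p_mul_p]; noncomm_ring
      _ = p * P * p := by rw [hV.mul_inv]; noncomm_ring
  have e₂ : q' - q' * V * p * (c + p * y * β) = q' * Q * q' := by
    calc _ = q' - q' * V * (p * p) * W' := by rw [← hpW]; noncomm_ring
      _ = q' - q' * V * (W' * q') := by rw [h.p_mul_p, hWq, ← hpW]; noncomm_ring
      _ = q' * q' - q' * (V * W') * q' := by rw [h'.q_mul_q]; noncomm_ring
      _ = q' * Q * q' := by rw [hV.inv_mul]; noncomm_ring
  rw [e₁, e₂]
  constructor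
  · calc _ = p * (P * (p * r * q') * Q) * q' := by noncomm_ring
      _ = 0 := by rw [(hV.orth _).1]; simp
  · calc _ = q' * (Q * (q' * r * p) * P) * p := by noncomm_ring
      _ = 0 := by rw [(hV.orth _).2]; simp

/-- Every unimodular pair `(a, b)` extends: `a + y b` is quasi-invertible for some `y`. -/
def Completable {R : Type*} [Ring R] (a : R) : Prop :=
  ∀ x b : R, x * a + b = 1 → ∃ y : R, QuasiInv (a + y * b)

namespace Completable

variable {R : Type*} [Ring R] {a : R}

theorem of_units (g h : Rˣ) (H : Completable (g * a * h)) : Completable a := by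
  intro x b hxb
  obtain ⟨y, hy⟩ := H ((h⁻¹ : Rˣ) * x * (g⁻¹ : Rˣ)) ((h⁻¹ : Rˣ) * b * h) <| by
    calc _ = (h⁻¹ : Rˣ) * (x * a + b) * h := by simp [mul_add, add_mul, mul_assoc]
      _ = 1 := by rw [hxb]; simp
  refine ⟨(g⁻¹ : Rˣ) * y * (h⁻¹ : Rˣ), (QuasiInv.units_mul_mul_iff g h).1 ?_⟩
  convert hy using 1
  simp [mul_add, add_mul, mul_assoc]

theorem of_forall (H : ∀ x b : R, x * a + b = 1 → ∃ (g : Rˣ) (y : R),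
    Completable (g * a + y * b)) : Completable a := by
  intro x b hxb
  obtain ⟨g, y, hgy⟩ := H x b hxb
  obtain ⟨z, hz⟩ := hgy (x * (g⁻¹ : Rˣ)) ((1 - x * (g⁻¹ : Rˣ) * y) * b) <| by
    refine Eq.trans ?_ hxb
    simp [mul_add, sub_mul, mul_assoc]
  refine ⟨(g⁻¹ : Rˣ) * (y + z * (1 - x * (g⁻¹ : Rˣ) * y)),
    (QuasiInv.units_mul_mul_iff g 1).1 ?_⟩
  convert hz using 1
  simp [mul_add, add_mul, mul_assoc, add_assoc]

end Completable

namespace IsQB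

variable {R : Type*} [Ring R]

open Matrix

theorem of_ringEquiv {S : Type*} [Ring S] (e : R ≃+* S) (hR : IsQB R) : IsQB S := by
  intro a x b h
  obtain ⟨y, hy⟩ := hR (e.symm a) (e.symm x) (e.symm b) (by rw [← map_mul, ← map_add, h, map_one])
  exact ⟨e y, by simpa using hy.map e⟩

/-- The elementary matrix with upper right entry `t`. -/
def upper (t : R) : (Matrix (Fin 2) (Fin 2) R)ˣ :=
  unitOneAdd !![0, t; 0, 0] (by simp [← Matrix.ext_iff])

/-- The elementary matrix with lower left entry `t`. -/
def lower (t : R) : (Matrix (Fin 2) (Fin 2) R)ˣ :=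
  unitOneAdd !![0, 0; t, 0] (by simp [← Matrix.ext_iff])

theorem val_upper (t : R) : (upper t : Matrix (Fin 2) (Fin 2) R) = !![1, t; 0, 1] := by
  simp [upper, Matrix.one_fin_two]

theorem val_lower (t : R) : (lower t : Matrix (Fin 2) (Fin 2) R) = !![1, 0; t, 1] := by
  simp [lower, Matrix.one_fin_two]

theorem quasiInv_antidiag {u v p q u' v' p' q' w s w' s' : R}
    (h : QuasiInverse u v p q) (h' : QuasiInverse u' v' p' q')
    (hpw : p * w = w) (hwq : w * q' = w) (hqs : q' * s = s) (hsp : s * p = s)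
    (hpw' : p' * w' = w') (hwq' : w' * q = w') (hqs' : q * s' = s') (hsp' : s' * p' = s')
    (hw : CentOrth (p - w * s) (q' - s * w)) (hw' : CentOrth (p' - w' * s') (q - s' * w')) :
    QuasiInv !![u, w; w', u'] := by
  have e₁ : 1 - !![u, w; w', u'] * !![v, s'; s, v'] = !![p - w * s, 0; 0, p' - w' * s'] := by
    have t₁ : u * s' = 0 := by rw [← hqs', ← mul_assoc, h.mul_q, zero_mul]
    have t₂ : w * v' = 0 := by rw [← hwq, mul_assoc, h'.q_mul, mul_zero]
    have t₃ : w' * v = 0 := by rw [← hwq', mul_assoc, h.q_mul, mul_zero]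
    have t₄ : u' * s = 0 := by rw [← hqs, ← mul_assoc, h'.mul_q, zero_mul]
    rw [Matrix.mul_fin_two, h.mul_inv, h'.mul_inv, t₁, t₂, t₃, t₄, Matrix.one_fin_two]
    simp [sub_add_eq_sub_sub]
    exact funext fun i => by simp
  have e₂ : 1 - !![v, s'; s, v'] * !![u, w; w', u'] = !![q - s' * w', 0; 0, q' - s * w] := by
    have t₁ : v * w = 0 := by rw [← hpw, ← mul_assoc, h.mul_p, zero_mul]
    have t₂ : s' * u' = 0 := by rw [← hsp', mul_assoc, h'.p_mul, mul_zero]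
    have t₃ : s * u = 0 := by rw [← hsp, mul_assoc, h.p_mul, mul_zero]
    have t₄ : v' * w' = 0 := by rw [← hpw', ← mul_assoc, h'.mul_p, zero_mul]
    rw [Matrix.mul_fin_two, h.inv_mul, h'.inv_mul, t₁, t₂, t₃, t₄, Matrix.one_fin_two]
    simp [sub_add_eq_sub_sub]
    exact funext fun i => by simp
  have o₁ : CentOrth (p - w * s) (q - s' * w') := by
    have l : p - w * s = p * (1 - w * s) := by rw [mul_sub, ← mul_assoc, hpw, mul_one]
    have l' : p - w * s = (1 - w * s) * p := by rw [sub_mul, mul_assoc, hsp, one_mul]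
    have k : q - s' * w' = (1 - s' * w') * q := by rw [sub_mul, mul_assoc, hwq', one_mul]
    have k' : q - s' * w' = q * (1 - s' * w') := by rw [mul_sub, ← mul_assoc, hqs', mul_one]
    intro r
    constructor
    · rw [l, k]
      simpa only [mul_assoc] using (h.orth ((1 - w * s) * r * (1 - s' * w'))).1
    · rw [l', k']
      simpa only [mul_assoc] using (h.orth ((1 - s' * w') * r * (1 - w * s))).2
  have o₂ : CentOrth (p' - w' * s') (q' - s * w) := by
    have l : p' - w' * s' = p' * (1 - w' * s') := by rw [mul_sub, ← mul_assoc, hpw', mul_one]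
    have l' : p' - w' * s' = (1 - w' * s') * p' := by rw [sub_mul, mul_assoc, hsp', one_mul]
    have k : q' - s * w = (1 - s * w) * q' := by rw [sub_mul, mul_assoc, hwq, one_mul]
    have k' : q' - s * w = q' * (1 - s * w) := by rw [mul_sub, ← mul_assoc, hqs, mul_one]
    intro r
    constructor
    · rw [l, k]
      simpa only [mul_assoc] using (h'.orth ((1 - w' * s') * r * (1 - s * w))).1
    · rw [l', k']
      simpa only [mul_assoc] using (h'.orth ((1 - s * w) * r * (1 - w' * s'))).2
  refine ⟨!![v, s'; s, v'], !![v, s'; s, v'], fun r => ?_⟩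
  rw [e₁, e₂, Matrix.eta_fin_two r]
  simp only [Matrix.mul_fin_two, zero_mul, mul_zero, add_zero, zero_add, (o₁ _).1, (o₁ _).2,
    (o₂ _).1, (o₂ _).2, (hw _).1, (hw _).2, (hw' _).1, (hw' _).2]
  constructor <;> exact (Matrix.eta_fin_two 0).symm

theorem completable_of_reduced (hR : IsQB R) {u v p q u' v' p' q' c d : R}
    (h : QuasiInverse u v p q) (h' : QuasiInverse u' v' p' q')
    (hpc : p * c = c) (hcq : c * q' = c) (hpd : p' * d = d) (hdq : d * q = d) :
    Completable !![u, c; d, u'] := by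
  intro X W hXW
  rw [Matrix.eta_fin_two X, Matrix.eta_fin_two W, Matrix.mul_fin_two, Matrix.one_fin_two] at hXW
  rw [Matrix.eta_fin_two W]
  generalize X 0 0 = x₁, X 0 1 = x₂, X 1 0 = x₃, X 1 1 = x₄, W 0 0 = w₁, W 0 1 = w₂,
    W 1 0 = w₃, W 1 1 = w₄ at hXW
  simp at hXW
  obtain ⟨⟨h₁, -⟩, -, h₂⟩ := hXW
  obtain ⟨y, s, hpy, hyq, hqs, hsp, hw⟩ := hR.exists_skew h h' (x := q' * x₃ * p)
    (β := q' * w₄ * q') hpc hcq (by rw [mul_assoc, h.p_mul_p])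
    (by rw [← mul_assoc, ← mul_assoc, h'.q_mul_q]) (by rw [mul_assoc, h'.q_mul_q]) <| by
      calc _ = q' * x₃ * (p * (c * q')) + q' * x₄ * (u' * q') + q' * w₄ * q' := by
            rw [h'.mul_q, hcq]; simp [mul_assoc]
        _ = q' * (x₃ * c + x₄ * u' + w₄) * q' := by rw [hcq, hpc]; nth_rw 1 [← hcq]; noncomm_ring
        _ = q' := by rw [h₂, mul_one, h'.q_mul_q]
  obtain ⟨y', s', hpy', hyq', hqs', hsp', hw'⟩ := hR.exists_skew h' h (x := q * x₂ * p')
    (β := q * w₁ * q) hpd hdq (by rw [mul_assoc, h'.p_mul_p])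
    (by rw [← mul_assoc, ← mul_assoc, h.q_mul_q]) (by rw [mul_assoc, h.q_mul_q]) <| by
      calc _ = q * x₂ * (p' * (d * q)) + q * x₁ * (u * q) + q * w₁ * q := by
            rw [h.mul_q, hdq]; simp [mul_assoc]
        _ = q * (x₁ * u + x₂ * d + w₁) * q := by rw [hdq, hpd]; nth_rw 1 [← hdq]; noncomm_ring
        _ = q := by rw [h₁, mul_one, h.q_mul_q]
  have hvy : v * y = 0 := by rw [← hpy, ← mul_assoc, h.mul_p, zero_mul]
  have hvy' : v' * y' = 0 := by rw [← hpy', ← mul_assoc, h'.mul_p, zero_mul]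
  have hvc : v * c = 0 := by rw [← hpc, ← mul_assoc, h.mul_p, zero_mul]
  have hvd : v' * d = 0 := by rw [← hpd, ← mul_assoc, h'.mul_p, zero_mul]
  refine ⟨!![0, y; y', 0], ?_⟩
  set Y : Matrix (Fin 2) (Fin 2) R := !![0, y; y', 0] with hY
  set D : Matrix (Fin 2) (Fin 2) R := !![v, 0; 0, v'] with hD
  generalize hWm : !![w₁, w₂; w₃, w₄] = W'
  have hDY : D * Y = 0 := by
    rw [hD, hY, Matrix.mul_fin_two, hvy, hvy', Matrix.eta_fin_two 0]
    simp
  have hsq : -(Y * W' * D) * -(Y * W' * D) = 0 := by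
    calc _ = Y * W' * (D * Y) * W' * D := by noncomm_ring
      _ = 0 := by rw [hDY]; simp
  refine (QuasiInv.units_mul_mul_iff (unitOneAdd _ hsq) 1).1 ?_
  have hDA : D * !![u, c; d, u'] = 1 - !![q, 0; 0, q'] := by
    rw [hD, Matrix.mul_fin_two, h.inv_mul, h'.inv_mul, hvc, hvd, Matrix.one_fin_two]
    simp
  have key : (1 + -(Y * W' * D)) * (!![u, c; d, u'] + Y * W') =
      !![u, c + y * (q' * w₄ * q'); d + y' * (q * w₁ * q), u'] := by
    calc _ = !![u, c; d, u'] + Y * W' - Y * W' * (D * !![u, c; d, u'])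
          - Y * W' * (D * Y) * W' := by noncomm_ring
      _ = !![u, c; d, u'] + Y * W' * !![q, 0; 0, q'] := by rw [hDA, hDY]; noncomm_ring
      _ = _ := by
        have t₁ : y * w₃ * q = 0 := by rw [← hpy, mul_assoc p, (h.orth _).1]
        have t₂ : y' * w₂ * q' = 0 := by rw [← hpy', mul_assoc p', (h'.orth _).1]
        have t₃ : y * (q' * w₄ * q') = y * w₄ * q' := by
          rw [← mul_assoc, ← mul_assoc, hyq]
        have t₄ : y' * (q * w₁ * q) = y' * w₁ * q := by
          rw [← mul_assoc, ← mul_assoc, hyq']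
        rw [← hWm, hY, t₃, t₄]
        simp [t₁, t₂]
  rw [Units.val_one, mul_one, val_unitOneAdd, key]
  refine quasiInv_antidiag h h' ?_ ?_ hqs hsp ?_ ?_ hqs' hsp' hw hw'
  · rw [mul_add, hpc, ← mul_assoc, hpy]
  · simp only [add_mul, mul_assoc, hcq, h'.q_mul_q]
  · rw [mul_add, hpd, ← mul_assoc, hpy']
  · simp only [add_mul, mul_assoc, hdq, h.q_mul_q]

theorem completable_of_diag (hR : IsQB R) {u v p q u' c d : R}
    (h : QuasiInverse u v p q) (h' : QuasiInv u') (hpc : p * c = c) (hdq : d * q = d) :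
    Completable !![u, c; d, u'] := by
  obtain ⟨v', p', q', h'⟩ := h'.exists_quasiInverse
  have hcd (r : R) : c * r * d = 0 := by
    rw [← hpc, ← hdq]
    calc _ = p * (c * r * d) * q := by noncomm_ring
      _ = 0 := (h.orth _).1
  refine .of_units (upper (-(c * v'))) (lower (-(v' * d))) ?_
  have : (upper (-(c * v')) * !![u, c; d, u'] * lower (-(v' * d)) : Matrix (Fin 2) (Fin 2) R) =
      !![u, c * q'; p' * d, u'] := by
    have hcv : c * v' * u' = c - c * q' := by rw [mul_assoc, h'.inv_mul]; noncomm_ring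
    have hvd : u' * (v' * d) = d - p' * d := by rw [← mul_assoc, h'.mul_inv]; noncomm_ring
    have hz : c * q' * (v' * d) = 0 := by rw [← mul_assoc, mul_assoc c, h'.q_mul]; simp
    simp [val_upper, val_lower, hcd, hcv, hvd, hz]
  rw [this]
  refine completable_of_reduced hR h h' ?_ ?_ ?_ ?_
  · rw [← mul_assoc, hpc]
  · rw [mul_assoc, h'.q_mul_q]
  · rw [← mul_assoc, h'.p_mul_p]
  · rw [mul_assoc, hdq]

theorem completable_of_corner (hR : IsQB R) {u v p q a c d : R}
    (h : QuasiInverse u v p q) (hpc : p * c = c) :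
    Completable !![u, c; d, a] := by
  refine .of_forall fun X W hXW => ?_
  rw [Matrix.eta_fin_two X, Matrix.eta_fin_two W, Matrix.mul_fin_two, Matrix.one_fin_two] at hXW
  rw [Matrix.eta_fin_two W]
  generalize X 0 0 = x₁, X 0 1 = x₂, X 1 0 = x₃, X 1 1 = x₄, W 0 0 = w₁, W 0 1 = w₂,
    W 1 0 = w₃, W 1 1 = w₄ at hXW
  simp at hXW
  obtain ⟨-, -, h₂⟩ := hXW
  obtain ⟨y, hy⟩ := hR a x₄ (x₃ * c + w₄) (by rw [← h₂]; abel)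
  have hvc : v * c = 0 := by rw [← hpc, ← mul_assoc, h.mul_p, zero_mul]
  set e := y * x₃ * u + d + y * w₃ with he
  refine ⟨lower (-(e * v)) * lower (y * x₃), 
    (lower (-(e * v)) : Matrix (Fin 2) (Fin 2) R) * !![0, 0; 0, y], ?_⟩
  have : (lower (-(e * v)) * lower (y * x₃) : (Matrix (Fin 2) (Fin 2) R)ˣ).val *
      !![u, c; d, a] + (lower (-(e * v))).val * !![0, 0; 0, y] * !![w₁, w₂; w₃, w₄] =
      !![u, c; e * q, a + y * (x₃ * c + w₄)] := by
    have t : e * q = e - e * v * u := by rw [mul_assoc, h.inv_mul]; noncomm_ring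
    have t' : e * v * c = 0 := by rw [mul_assoc, hvc, mul_zero]
    rw [t, Units.val_mul, mul_assoc, mul_assoc, ← mul_add]
    simp [val_lower, t']
    constructor
    · rw [he]; noncomm_ring
    · noncomm_ring
  rw [this]
  exact completable_of_diag hR h hy hpc (by rw [mul_assoc, h.q_mul_q])

theorem completable_of_quasiInv (hR : IsQB R) {u a c d : R} (h : QuasiInv u) :
    Completable !![u, c; d, a] := by
  obtain ⟨v, p, q, h⟩ := h.exists_quasiInverse
  refine .of_units 1 (upper (-(v * c))) ?_
  have : ((1 : (Matrix (Fin 2) (Fin 2) R)ˣ) * !![u, c; d, a] * upper (-(v * c)) :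
      Matrix (Fin 2) (Fin 2) R) = !![u, p * c; d, a - d * (v * c)] := by
    have t : u * (v * c) = c - p * c := by rw [← mul_assoc, h.mul_inv]; noncomm_ring
    simp [val_upper, t]
    abel
  rw [this]
  exact completable_of_corner hR h (by rw [← mul_assoc, h.p_mul_p])

theorem matrix_two (hR : IsQB R) : IsQB (Matrix (Fin 2) (Fin 2) R) := by
  intro A
  change Completable A
  rw [Matrix.eta_fin_two A]
  generalize A 0 0 = a₁, A 0 1 = a₂, A 1 0 = a₃, A 1 1 = a₄
  refine .of_forall fun X W hXW => ?_
  rw [Matrix.eta_fin_two X, Matrix.eta_fin_two W, Matrix.mul_fin_two, Matrix.one_fin_two] at hXW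
  rw [Matrix.eta_fin_two W]
  generalize X 0 0 = x₁, X 0 1 = x₂, X 1 0 = x₃, X 1 1 = x₄, W 0 0 = w₁, W 0 1 = w₂,
    W 1 0 = w₃, W 1 1 = w₄ at hXW
  simp at hXW
  obtain ⟨⟨h₁, -⟩, -, -⟩ := hXW
  obtain ⟨y, hy⟩ := hR a₁ x₁ (x₂ * a₃ + w₁) (by rw [← h₁]; abel)
  refine ⟨upper (y * x₂), !![y, 0; 0, 0], ?_⟩
  have : a₁ + y * x₂ * a₃ + y * w₁ = a₁ + y * (x₂ * a₃ + w₁) := by noncomm_ring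
  simp only [val_upper, Matrix.mul_fin_two]
  simp [this]
  exact completable_of_quasiInv hR hy

theorem matrix_two_pow (hR : IsQB R) (k : ℕ) :
    IsQB (Matrix (Fin (2 ^ k)) (Fin (2 ^ k)) R) := by
  induction k with
  | zero => exact hR.of_ringEquiv (Matrix.uniqueRingEquiv (m := Fin 1)).symm
  | succ k ih =>
    exact ih.matrix_two.of_ringEquiv ((Matrix.compRingEquiv _ _ R).trans
      (Matrix.reindexRingEquiv R (finProdFinEquiv.trans (finCongr (pow_succ' 2 k).symm))))

theorem matrix_of_sum {m n : Type*} [Fintype m] [Fintype n] [DecidableEq m] [DecidableEq n]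
    (hR : IsQB (Matrix (m ⊕ n) (m ⊕ n) R)) : IsQB (Matrix m m R) := by
  intro a x b h
  obtain ⟨Y, hY⟩ := hR (fromBlocks a 0 0 1) (fromBlocks x 0 0 1) (fromBlocks b 0 0 0) <| by
    simp [fromBlocks_multiply, fromBlocks_add, h]
  rw [← fromBlocks_toBlocks Y] at hY
  generalize Y.toBlocks₁₁ = y, Y.toBlocks₁₂ = y₂, Y.toBlocks₂₁ = y₃, Y.toBlocks₂₂ = y₄ at hY
  have hsq : (fromBlocks 0 0 (-(y₃ * b)) 0 : Matrix (m ⊕ n) (m ⊕ n) R) *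
      fromBlocks 0 0 (-(y₃ * b)) 0 = 0 := by simp [fromBlocks_multiply]
  have hY' := hY.mul_units 1 (unitOneAdd _ hsq)
  rw [val_unitOneAdd, Units.val_one, one_mul, ← fromBlocks_one] at hY'
  simp only [fromBlocks_multiply, fromBlocks_add] at hY'
  simp at hY'
  obtain ⟨A, B, hAB⟩ := hY'
  refine ⟨y, A.toBlocks₁₁, B.toBlocks₁₁, fun r => ?_⟩
  rw [← fromBlocks_toBlocks A, ← fromBlocks_toBlocks B] at hAB
  have := hAB (fromBlocks r 0 0 0)
  simp [← fromBlocks_one, fromBlocks_multiply, sub_eq_add_neg, fromBlocks_neg, fromBlocks_add] at this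
  rw [← fromBlocks_zero] at this
  simp only [fromBlocks_inj] at this
  simpa [sub_eq_add_neg] using And.intro this.1.1 this.2.1

end IsQB

/-- Theorem 6.4: matrix rings over a QB-ring are QB-rings. -/
theorem matrix_isQB {R : Type*} [Ring R] (hR : IsQB R) (n : ℕ) (hn : 1 ≤ n) :
    IsQB (Matrix (Fin n) (Fin n) R) := by
  have e : Fin (2 ^ n) ≃ Fin n ⊕ Fin (2 ^ n - n) :=
    (finCongr (by have := n.lt_two_pow_self; omega)).trans finSumFinEquiv.symm
  exact ((hR.matrix_two_pow n).of_ringEquiv (Matrix.reindexRingEquiv R e)).matrix_of_sum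
end

section
/- Let R be a unital QB-ring, I a two-sided ideal of R, and π : R → R/I the quotient map. Then π maps the set of quasi-invertible elements of R onto the set of quasi-invertible elements of R/I; that is, every quasi-invertible element of R/I lifts to a quasi-invertible element of R. -/
/-- A quasi-invertible element has a reflexive inner inverse whose defect elements are
centrally orthogonal. -/
theorem QuasiInv.exists_reflexive_inverse {R : Type*} [Ring R] {u : R} (hu : QuasiInv u) :
    ∃ v : R, u * v * u = u ∧ v * u * v = v ∧ CentOrth (1 - u * v) (1 - v * u) := by
  obtain ⟨a, b, h⟩ := hu
  set c := a + b - a * u * b with hc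
  have h₁ : 1 - u * c = (1 - u * a) * (1 - u * b) := by rw [hc]; noncomm_ring
  have h₂ : 1 - c * u = (1 - a * u) * (1 - b * u) := by rw [hc]; noncomm_ring
  have hreg : u * c * u = u := by
    have key : u - u * c * u = (1 - u * a) * u * (1 - b * u) := by rw [hc]; noncomm_ring
    rw [(h u).1] at key
    exact (sub_eq_zero.mp key).symm
  have huv : u * (c * u * c) = u * c := by
    rw [← mul_assoc, ← mul_assoc, hreg]
  have hvu : c * u * c * u = c * u := by
    rw [mul_assoc, mul_assoc, ← mul_assoc u, hreg]
  refine ⟨c * u * c, by rw [huv, hreg], by rw [hvu, ← mul_assoc, ← mul_assoc, hvu], ?_⟩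
  rw [huv, hvu, h₁, h₂]
  intro r
  constructor
  · calc (1 - u * a) * (1 - u * b) * r * ((1 - a * u) * (1 - b * u))
        = (1 - u * a) * ((1 - u * b) * r * (1 - a * u)) * (1 - b * u) := by
          simp only [mul_assoc]
      _ = 0 := (h _).1
  · calc (1 - a * u) * (1 - b * u) * r * ((1 - u * a) * (1 - u * b))
        = (1 - a * u) * ((1 - b * u) * r * (1 - u * a)) * (1 - u * b) := by
          simp only [mul_assoc]
      _ = 0 := by rw [(h r).2, mul_zero, zero_mul]

/-- Every inner inverse of a quasi-invertible element is quasi-invertible. -/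
theorem QuasiInv.of_inner_inverse {R : Type*} [Ring R] {u y : R} (hu : QuasiInv u)
    (hy : u * y * u = u) : QuasiInv y := by
  obtain ⟨t, ht, -, h⟩ := hu.exists_reflexive_inverse
  have h₁ : 1 - u * y = (1 - u * y) * (1 - u * t) := by
    have : (1 - u * y) * (1 - u * t) = 1 - u * y - (u - u * y * u) * t := by noncomm_ring
    rw [this, hy, sub_self, zero_mul, sub_zero]
  have h₂ : 1 - y * u = (1 - t * u) * (1 - y * u) := by
    have : (1 - t * u) * (1 - y * u) = 1 - y * u - t * (u - u * y * u) := by noncomm_ring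
    rw [this, hy, sub_self, mul_zero, sub_zero]
  refine ⟨u, u, fun r => ?_⟩
  rw [h₁, h₂]
  constructor
  · calc (1 - t * u) * (1 - y * u) * r * ((1 - u * y) * (1 - u * t))
        = (1 - t * u) * ((1 - y * u) * r * (1 - u * y)) * (1 - u * t) := by
          simp only [mul_assoc]
      _ = 0 := (h _).2
  · calc (1 - u * y) * (1 - u * t) * r * ((1 - t * u) * (1 - y * u))
        = (1 - u * y) * ((1 - u * t) * (r * (1 - t * u))) * (1 - y * u) := by
          simp only [mul_assoc]
      _ = 0 := by
          rw [← mul_assoc (1 - u * t), (h r).1, mul_zero, zero_mul]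

/-- Surjective ring homomorphisms preserve quasi-invertibility. -/
theorem QuasiInv.map_s16 {R S : Type*} [Ring R] [Ring S] (f : R →+* S)
    (hf : Function.Surjective f) {u : R} (hu : QuasiInv u) : QuasiInv (f u) := by
  obtain ⟨a, b, h⟩ := hu
  refine ⟨f a, f b, fun s => ?_⟩
  obtain ⟨r, rfl⟩ := hf s
  simp only [← map_one f, ← map_mul, ← map_sub, (h r).1, (h r).2, map_zero, and_self]

/-- An inner inverse of the image of a quasi-invertible element lifts to a quasi-invertible
element. -/
theorem QuasiInv.exists_lift_inner_inverse {R S : Type*} [Ring R] [Ring S] (f : R →+* S)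
    (hf : Function.Surjective f) {u : R} (hu : QuasiInv u) {w : S}
    (hw : f u * w * f u = f u) : ∃ y : R, QuasiInv y ∧ f y = w := by
  obtain ⟨t, hut, htu, -⟩ := hu.exists_reflexive_inverse
  obtain ⟨y, rfl⟩ := hf w
  refine ⟨y + t - t * (u * y * u) * t, hu.of_inner_inverse ?_, ?_⟩
  · have : u * (y + t - t * (u * y * u) * t) * u
        = u * y * u + u * t * u - (u * t * u) * y * (u * t * u) := by noncomm_ring
    rw [this, hut]
    abel
  · have : f (t * (u * y * u) * t) = f t := by
      rw [map_mul, map_mul, map_mul, map_mul, hw, ← map_mul, ← map_mul, htu]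
    rw [map_sub, map_add, this, add_sub_cancel_right]

/-- Quasi-invertible elements lift along surjective homomorphisms from a QB-ring. -/
theorem IsQB.exists_quasiInv_lift {R S : Type*} [Ring R] [Ring S] (hR : IsQB R) (f : R →+* S)
    (hf : Function.Surjective f) {w : S} (hw : QuasiInv w) : ∃ y : R, QuasiInv y ∧ f y = w := by
  obtain ⟨v, hwv, hvw, h⟩ := hw.exists_reflexive_inverse
  obtain ⟨y, hy⟩ := hf w
  obtain ⟨x, hx⟩ := hf v
  obtain ⟨z, hz⟩ := hR x y (1 - y * x) (add_sub_cancel _ _)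
  refine hz.exists_lift_inner_inverse f hf ?_
  have hfu : f (x + z * (1 - y * x)) = v + f z * (1 - w * v) := by
    simp only [map_add, map_mul, map_sub, map_one, hx, hy]
  have hmul : (v + f z * (1 - w * v)) * w = v * w := by
    have : (v + f z * (1 - w * v)) * w = v * w + f z * (w - w * v * w) := by noncomm_ring
    rw [this, hwv, sub_self, mul_zero, add_zero]
  have horth : v * w * (f z * (1 - w * v)) = f z * (1 - w * v) := by
    have := (h (f z)).2
    rw [sub_mul, sub_mul, one_mul, sub_eq_zero] at this
    rw [← mul_assoc]
    exact this.symm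
  rw [hfu, hmul, mul_add, hvw, horth]

/-- Proposition 7.1: if `R` is a QB-ring and `I` a two-sided ideal, then the quotient
map carries the quasi-invertible elements of `R` onto those of `R/I`. -/
theorem quasiInv_lifts {R : Type*} [Ring R] (hR : IsQB R) (I : TwoSidedIdeal R) :
    (RingCon.mk' I.ringCon) '' {u : R | QuasiInv u} =
      {w : I.ringCon.Quotient | QuasiInv w} := by
  have hf : Function.Surjective (RingCon.mk' I.ringCon) := RingCon.mk'_surjective I.ringCon
  ext w
  constructor
  · rintro ⟨u, hu, rfl⟩
    exact QuasiInv.map_s16 _ hf hu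
  · exact fun hw => hR.exists_quasiInv_lift _ hf hw
end

section
/- Let R be a unital exchange ring, i.e. for every a in R there exists an idempotent p ∈ a R with 1 - p ∈ (1-a) R. Then the following are equivalent: (i) R is a QB-ring; (ii) for every von Neumann regular element a of R there exists a quasi-invertible element u with a ≤ u; (iii) for every von Neumann regular element x of R there exists a quasi-invertible element v with x = x v x. -/
/-- `R` is an exchange ring: for every `a` there is an idempotent `p ∈ a R` with
`1 - p ∈ (1 - a) R`. -/
def IsExchange (R : Type*) [Ring R] : Prop :=
  ∀ a : R, ∃ p : R, IsIdempotentElem p ∧ (∃ r : R, p = a * r) ∧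
    (∃ s : R, 1 - p = (1 - a) * s)

/-- `a` is von Neumann regular. -/
def VNRegular {R : Type*} [Ring R] (a : R) : Prop :=
  ∃ x : R, a = a * x * a

/-- The extension order on von Neumann regular elements. -/
def RegLe {R : Type*} [Ring R] (a b : R) : Prop :=
  ∃ x : R, a = a * x * b ∧ a = b * x * a ∧ a = a * x * a

section

variable {R : Type*} [Ring R]

theorem CentOrth.mul_mul {x y : R} (h : CentOrth x y) (c d : R) : CentOrth (x * c) (d * y) := by
  intro r
  constructor
  · rw [show x * c * r * (d * y) = x * (c * r * d) * y by noncomm_ring]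
    exact (h _).1
  · have := (h r).2
    rw [show d * y * r * (x * c) = d * (y * r * x) * c by noncomm_ring, this]
    simp

theorem CentOrth.mul_mul' {x y : R} (h : CentOrth x y) (c d : R) : CentOrth (c * x) (y * d) := by
  intro r
  constructor
  · rw [show c * x * r * (y * d) = c * (x * r * y) * d by noncomm_ring, (h r).1]
    simp
  · rw [show y * d * r * (c * x) = y * (d * r * c) * x by noncomm_ring]
    exact (h _).2

theorem CentOrth.symm {x y : R} (h : CentOrth x y) : CentOrth y x :=
  fun r => ⟨(h r).2, (h r).1⟩

/-- A quasi-invertible element has a quasi-inverse which is also a partial inverse. -/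
theorem QuasiInv.exists_partial_inverse {u : R} (h : QuasiInv u) :
    ∃ v : R, u * v * u = u ∧ CentOrth (1 - u * v) (1 - v * u) := by
  obtain ⟨a, b, hab⟩ := h
  obtain ⟨w, hw⟩ : ∃ w, w = a + b - a * u * b := ⟨_, rfl⟩
  have hu : u * w * u = u := by
    have h := (hab u).1
    have e : (1 - u * a) * u * (1 - b * u) = u - u * w * u := by
      rw [hw]; noncomm_ring
    rw [e] at h
    exact (sub_eq_zero.mp h).symm
  have ho : CentOrth (1 - u * w) (1 - w * u) := by
    have h := hab.mul_mul (1 - u * b) (1 - a * u)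
    rwa [show (1 - u * a) * (1 - u * b) = 1 - u * w by rw [hw]; noncomm_ring,
      show (1 - a * u) * (1 - b * u) = 1 - w * u by rw [hw]; noncomm_ring] at h
  exact ⟨w, hu, ho⟩

theorem QuasiInv.mul_of_mul_eq_one {u c d : R} (h : QuasiInv u) (hcd : c * d = 1)
    (hdc : d * c = 1) : QuasiInv (u * c) := by
  obtain ⟨a, b, hab⟩ := h
  refine ⟨d * a, d * b, ?_⟩
  have e₁ : 1 - u * c * (d * a) = 1 * (1 - u * a) := by
    rw [show u * c * (d * a) = u * (c * d) * a by noncomm_ring, hcd]; simp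
  have e₂ : 1 - d * b * (u * c) = d * ((1 - b * u) * c) := by
    rw [show d * ((1 - b * u) * c) = d * c - d * b * (u * c) by noncomm_ring, hdc]
  have h := (hab.mul_mul' 1 c).mul_mul 1 d
  rwa [mul_one, ← e₁, ← e₂] at h

/-- If `a = a v a` with `v` quasi-invertible, then `a` extends to a quasi-invertible element. -/
theorem QuasiInv.exists_regLe {a v : R} (hv : QuasiInv v) (ha : a = a * v * a) :
    ∃ u : R, QuasiInv u ∧ RegLe a u := by
  obtain ⟨w, hvw, ho⟩ := hv.exists_partial_inverse
  refine ⟨w + a * (1 - v * w) + (1 - w * v) * a, ⟨v, v, ?_⟩, v, ?_, ?_, ha⟩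
  · have h := ho.symm.mul_mul (1 - a * v) (1 - v * a)
    have e₁ : 1 - (w + a * (1 - v * w) + (1 - w * v) * a) * v
        = (1 - w * v) * (1 - a * v) - a * (v - v * w * v) := by noncomm_ring
    have e₂ : 1 - v * (w + a * (1 - v * w) + (1 - w * v) * a)
        = (1 - v * a) * (1 - v * w) - (v - v * w * v) * a := by noncomm_ring
    rw [hvw, sub_self, mul_zero, sub_zero] at e₁
    rw [hvw, sub_self, zero_mul, sub_zero] at e₂
    rwa [e₁, e₂]
  · have e : a * v * (w + a * (1 - v * w) + (1 - w * v) * a)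
        = a * v * w + (a * v * a) * (1 - v * w) + a * (v - v * w * v) * a := by noncomm_ring
    rw [e, ← ha, hvw]
    noncomm_ring
  · have e : (w + a * (1 - v * w) + (1 - w * v) * a) * v * a
        = w * v * a + a * (v - v * w * v) * a + (1 - w * v) * (a * v * a) := by noncomm_ring
    rw [e, ← ha, hvw]
    noncomm_ring

/-- If `a ≤ u` with `u` quasi-invertible, then `a` has a quasi-invertible partial inverse. -/
theorem RegLe.exists_partial_inverse {a u : R} (h : RegLe a u) (hu : QuasiInv u) :
    ∃ v : R, QuasiInv v ∧ a = a * v * a := by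
  obtain ⟨w, huw, ho⟩ := hu.exists_partial_inverse
  obtain ⟨z, h₁, h₂, h₃⟩ := h
  refine ⟨w, ⟨u, u, ho.symm⟩, ?_⟩
  calc a = a * z * a := h₃
    _ = a * z * (u * z * a) := by rw [← h₂]
    _ = a * z * (u * w * u * z * a) := by rw [huw]
    _ = (a * z * u) * w * (u * z * a) := by noncomm_ring
    _ = a * w * a := by rw [← h₁, ← h₂]

theorem IsQB.exists_regLe (hQ : IsQB R) {a : R} (ha : VNRegular a) :
    ∃ u : R, QuasiInv u ∧ RegLe a u := by
  obtain ⟨z, hz⟩ := ha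
  obtain ⟨y, hy⟩ : ∃ y, z * a * z = y := ⟨_, rfl⟩
  have hay : a * y * a = a := by
    rw [← hy, show a * (z * a * z) * a = (a * z * a) * z * a by noncomm_ring, ← hz, ← hz]
  have hya : y * a * y = y := by
    rw [← hy, show z * a * z * a * (z * a * z) = z * (a * z * a) * z * a * z by noncomm_ring, ← hz,
      show z * a * z * a * z = z * (a * z * a) * z by noncomm_ring, ← hz]
  obtain ⟨t, ht⟩ := hQ a y (1 - y * a) (by noncomm_ring)
  have hn : (1 - y * a) * y = 0 := by rw [sub_mul, hya]; simp
  have hc : (1 + y * t * (1 - y * a)) * (1 - y * t * (1 - y * a)) = 1 := by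
    rw [show (1 + y * t * (1 - y * a)) * (1 - y * t * (1 - y * a))
      = 1 - y * t * ((1 - y * a) * y) * t * (1 - y * a) by noncomm_ring, hn]; simp
  have hd : (1 - y * t * (1 - y * a)) * (1 + y * t * (1 - y * a)) = 1 := by
    rw [show (1 - y * t * (1 - y * a)) * (1 + y * t * (1 - y * a))
      = 1 - y * t * ((1 - y * a) * y) * t * (1 - y * a) by noncomm_ring, hn]; simp
  refine ⟨_, ht.mul_of_mul_eq_one hd hc, ?_⟩
  have e : (a + t * (1 - y * a)) * (1 - y * t * (1 - y * a))
      = a + (1 - a * y) * t * (1 - y * a) := by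
    rw [show (a + t * (1 - y * a)) * (1 - y * t * (1 - y * a))
      = a + (1 - a * y) * t * (1 - y * a) - t * ((1 - y * a) * y) * t * (1 - y * a) by
        noncomm_ring, hn]
    simp
  rw [e]
  refine ⟨y, ?_, ?_, hay.symm⟩
  · rw [show a * y * (a + (1 - a * y) * t * (1 - y * a))
      = a * y * a + (a - a * y * a) * y * t * (1 - y * a) by noncomm_ring, hay]; simp
  · rw [show (a + (1 - a * y) * t * (1 - y * a)) * y * a
      = a * y * a + (1 - a * y) * t * ((1 - y * a) * y) * a by noncomm_ring, hn, hay]; simp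

/-- The exchange property is left-right symmetric. -/
theorem IsExchange.exists_left (hR : IsExchange R) (a : R) :
    ∃ q : R, IsIdempotentElem q ∧ (∃ t : R, q = t * a) ∧ ∃ k : R, 1 - q = k * (1 - a) := by
  obtain ⟨p, hp, ⟨r, hr⟩, s, hs⟩ := hR a
  obtain ⟨x, hx⟩ : ∃ x, x = r * p - s * (1 - p) := ⟨_, rfl⟩
  have hp' : p * p = p := hp
  have har : a * (r * p) = p := by rw [← mul_assoc, ← hr, hp']
  have has : (1 - a) * (s * (1 - p)) = 1 - p := by
    rw [← mul_assoc, ← hs, show (1 - p) * (1 - p) = 1 - p - p + p * p by noncomm_ring, hp']; simp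
  have hsx : s * (1 - p) = 1 - a * x := by
    rw [show 1 - a * x = 1 - a * (r * p) - (1 - a) * (s * (1 - p)) + s * (1 - p) by
      rw [hx]; noncomm_ring, har, has]; simp
  have hrx : r * p = 1 + (1 - a) * x := by
    rw [show 1 + (1 - a) * x = 1 - a * (r * p) - (1 - a) * (s * (1 - p)) + r * p by
      rw [hx]; noncomm_ring, har, has]; simp
  have ha : (1 - a * x) * (a * (1 + (1 - a) * x)) = 0 := by
    rw [← hsx, ← hrx, har, mul_assoc, sub_mul, hp']; simp
  have hb : (1 + (1 - a) * x) * ((1 - a) * (1 - a * x)) = 0 := by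
    rw [← hsx, ← hrx, has, mul_assoc, mul_sub, hp']; simp
  have hN : (1 + x * (1 - a)) * (1 - a * x) = 0 := by
    rw [show (1 + x * (1 - a)) * (1 - a * x) = (1 - a * x) * (a * (1 + (1 - a) * x))
      + (1 + (1 - a) * x) * ((1 - a) * (1 - a * x)) by noncomm_ring, ha, hb, add_zero]
  refine ⟨(1 + x * (1 - a)) * a, ?_, ⟨_, rfl⟩, 1 - x * a, by noncomm_ring⟩
  have h : (1 + x * (1 - a)) * a - (1 + x * (1 - a)) * a * ((1 + x * (1 - a)) * a)
      = (1 + x * (1 - a)) * (1 - a * x) * (a * (1 - a)) := by noncomm_ring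
  rw [hN, zero_mul] at h
  exact (sub_eq_zero.mp h).symm

theorem IsExchange.isQB (hR : IsExchange R)
    (h : ∀ a : R, VNRegular a → ∃ u : R, QuasiInv u ∧ RegLe a u) : IsQB R := by
  intro a x b hab
  obtain ⟨e, he, ⟨s, hs⟩, r, hr⟩ := hR.exists_left (x * a)
  have he' : e * e = e := he
  have hb : 1 - x * a = b := by rw [← hab]; simp
  rw [hb] at hr
  have hinv : e * s * x * (a * e) = e := by
    rw [show e * s * x * (a * e) = e * (s * (x * a)) * e by noncomm_ring, ← hs, he', he']
  obtain ⟨u, hu, z, -, h₂, h₃⟩ := h (a * e) ⟨e * s * x, by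
    rw [mul_assoc (a * e), hinv, mul_assoc, he']⟩
  obtain ⟨f, hf⟩ : ∃ f, f = z * (a * e) := ⟨_, rfl⟩
  have hfe : f * e = f := by rw [hf, mul_assoc, mul_assoc, he']
  have hef : e * f = e := by
    calc e * f = e * s * x * (a * e) * f := by rw [hinv]
      _ = e * s * x * (a * e * z * (a * e)) := by rw [hf]; noncomm_ring
      _ = e := by rw [← h₃, hinv]
  have hff : f * f = f := by
    calc f * f = f * (e * f) := by rw [← mul_assoc, hfe]
      _ = f := by rw [hef, hfe]
  have hsq : (f - e) * (f - e) = 0 := by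
    rw [show (f - e) * (f - e) = f * f - f * e - e * f + e * e by noncomm_ring,
      hff, hfe, hef, he']; simp
  have hc : (1 + (f - e)) * (1 - (f - e)) = 1 := by
    rw [show (1 + (f - e)) * (1 - (f - e)) = 1 - (f - e) * (f - e) by noncomm_ring, hsq, sub_zero]
  have hd : (1 - (f - e)) * (1 + (f - e)) = 1 := by
    rw [show (1 - (f - e)) * (1 + (f - e)) = 1 - (f - e) * (f - e) by noncomm_ring, hsq, sub_zero]
  have hue : u * (1 + (f - e)) * e = a * e := by
    rw [show u * (1 + (f - e)) * e = u * (e + f * e - e * e) by noncomm_ring, hfe, he',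
      add_sub_cancel_left, hf, ← mul_assoc, ← h₂]
  refine ⟨(u * (1 + (f - e)) - a) * r, ?_⟩
  have hu' := hu.mul_of_mul_eq_one hc hd
  generalize u * (1 + (f - e)) = w at *
  rwa [mul_assoc, ← hr, show a + (w - a) * (1 - e) = w - (w * e - a * e) by noncomm_ring, hue,
    sub_self, sub_zero]

end

/-- Theorem 8.4: an exchange ring is a QB-ring iff every von Neumann regular element
extends to a quasi-invertible element, iff every von Neumann regular element has a
quasi-invertible partial inverse. -/
theorem exchange_qb_characterization {R : Type*} [Ring R] (hR : IsExchange R) :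
    (IsQB R ↔ ∀ a : R, VNRegular a → ∃ u : R, QuasiInv u ∧ RegLe a u) ∧
    (IsQB R ↔ ∀ x : R, VNRegular x → ∃ v : R, QuasiInv v ∧ x = x * v * x) := by
  have h : IsQB R ↔ ∀ a : R, VNRegular a → ∃ u : R, QuasiInv u ∧ RegLe a u :=
    ⟨fun hQ _ ha => hQ.exists_regLe ha, hR.isQB⟩
  refine ⟨h, h.trans ⟨fun H x hx => ?_, fun H a ha => ?_⟩⟩
  · obtain ⟨u, hu, hxu⟩ := H x hx
    exact hxu.exists_partial_inverse hu
  · obtain ⟨v, hv, hav⟩ := H a ha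
    exact hv.exists_regLe hav
end
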